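/- arXiv:1902.09916 — 9 statements merged into one kernel-verified Lean document; each statement's English description precedes it below -/
import Mathlib

section
/- Let c be a positive integer and l ≥ 3 a positive integer, and let 𝐜 : ℕ → [c] be a c-coloring of the positive integers. Then there exist l-term arithmetic progressions Q₁, Q₂, Q₃, … (each with positive common difference) such that (i) Q₁ ≺ Q₂ ≺ Q₃ ≺ ⋯, and (ii) there is a color γ ∈ [c] such that for every nonempty finite set C of indices and every s ∈ {1, …, l}, the s-th term of the pointwise sum ⊕_{i∈C} Q_i has color γ, i.e. 𝐜(∑_{i∈C} Q_i[s]) = γ. -/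
section APHelpers
open Filter
attribute [local instance] Ultrafilter.add Ultrafilter.addSemigroup

theorem aph_minimal {S : Type*} [AddSemigroup S] [TopologicalSpace S] [CompactSpace S] [T2Space S]
    [Nonempty S] (hcont : ∀ r : S, Continuous (· + r)) :
    ∃ p : S, p + p = p ∧ ∀ r : S, r + r = r → r + p = r → p + r = r → r = p := by
  let F : Set (Set S) := { N | IsClosed N ∧ N.Nonempty ∧ ∀ x, ∀ m ∈ N, x + m ∈ N }
  obtain ⟨N, hN⟩ : ∃ N, Minimal (· ∈ F) N := by
    apply zorn_superset
    intro c hcs hc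
    refine ⟨⋂₀ c, ⟨isClosed_sInter fun t ht => (hcs ht).1, ?_, fun x m hm => ?_⟩,
      fun s hs => Set.sInter_subset_of_mem hs⟩
    · obtain rfl | hcnemp := c.eq_empty_or_nonempty
      · rw [Set.sInter_empty]
        exact Set.univ_nonempty
      · have := hcnemp.coe_sort
        rw [Set.sInter_eq_iInter]
        exact IsCompact.nonempty_iInter_of_directed_nonempty_isCompact_isClosed ((↑) : c → Set S)
          (DirectedOn.directed_val (IsChain.directedOn hc.symm)) (fun i => (hcs i.prop).2.1)
          (fun i => (hcs i.prop).1.isCompact) (fun i => (hcs i.prop).1)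
    · rw [Set.mem_sInter] at hm ⊢
      exact fun t ht => (hcs ht).2.2 x m (hm t ht)
  obtain ⟨hNc, hNn, hNi⟩ := hN.prop
  obtain ⟨p, hp, hpp⟩ := exists_idempotent_in_compact_add_subsemigroup hcont N hNn hNc.isCompact
    (fun x _ y hy => hNi x y hy)
  refine ⟨p, hpp, fun r hrr hrp hpr => ?_⟩
  have hr : r ∈ N := by rw [← hrp]; exact hNi _ _ hp
  have hR : Set.range (· + r) ∈ F := by
    refine ⟨(isCompact_range (hcont r)).isClosed, Set.range_nonempty _, ?_⟩
    rintro x _ ⟨y, rfl⟩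
    exact ⟨x + y, add_assoc _ _ _⟩
  have hsub : Set.range (· + r) ⊆ N := by
    rintro _ ⟨y, rfl⟩
    exact hNi _ _ hr
  obtain ⟨x, hx⟩ := hN.le_of_le hR hsub hp
  have hx : x + r = p := hx
  have : p + r = p := by rw [← hx, add_assoc, hrr]
  rw [← hpr, this]

theorem aph_map_add {M N : Type*} [AddSemigroup M] [AddSemigroup N] (f : M → N)
    (hf : ∀ x y, f (x + y) = f x + f y) (U V : Ultrafilter M) :
    (U + V).map f = U.map f + V.map f := by
  apply Ultrafilter.coe_inj.mp
  apply Filter.ext'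
  intro P
  rw [Ultrafilter.eventually_add]
  simp only [Ultrafilter.coe_map, Filter.eventually_map]
  rw [Ultrafilter.eventually_add]
  simp only [hf]

theorem aph_exists_q : ∃ (p : Ultrafilter ℕ) (q : Ultrafilter (ℕ × ℕ)), q + q = q ∧
    (∀ᶠ t : ℕ × ℕ in q, 0 < t.1 ∧ 0 < t.2) ∧ ∀ s : ℕ, q.map (fun t : ℕ × ℕ => t.1 + s * t.2) = p := by
  obtain ⟨p, hpp, hmin⟩ := aph_minimal (S := Ultrafilter ℕ) Ultrafilter.continuous_add_left
  let P : Ultrafilter (ℕ × ℕ) := p.map (fun a => (a, 0))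
  have hPP : P + P = P := by
    rw [← aph_map_add (fun a : ℕ => (a, 0)) (by simp), hpp]
  let V : Set (Ultrafilter (ℕ × ℕ)) := {U | ∀ᶠ t : ℕ × ℕ in U, 0 < t.1 ∧ 0 < t.2}
  have hVc : IsClosed V := ultrafilter_isClosed_basic {t : ℕ × ℕ | 0 < t.1 ∧ 0 < t.2}
  have hVl : ∀ U, ∀ W ∈ V, U + W ∈ V := by
    intro U W hW
    change ∀ᶠ t : ℕ × ℕ in ↑(U + W), 0 < t.1 ∧ 0 < t.2
    rw [Ultrafilter.eventually_add]
    refine Eventually.of_forall fun x => ?_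
    filter_upwards [hW] with y hy
    simp only [Prod.fst_add, Prod.snd_add]; omega
  have hVr : ∀ U ∈ V, ∀ W, U + W ∈ V := by
    intro U hU W
    change ∀ᶠ t : ℕ × ℕ in ↑(U + W), 0 < t.1 ∧ 0 < t.2
    rw [Ultrafilter.eventually_add]
    filter_upwards [hU] with x hx
    refine Eventually.of_forall fun y => ?_
    simp only [Prod.fst_add, Prod.snd_add]; omega
  have hVn : V.Nonempty := by
    refine ⟨pure (1, 1), ?_⟩
    change ∀ᶠ t : ℕ × ℕ in ((pure (1,1) : Ultrafilter (ℕ × ℕ)) : Filter (ℕ × ℕ)), 0 < t.1 ∧ 0 < t.2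
    simp
  obtain ⟨e, ⟨v, hv, hve⟩, hee⟩ := exists_idempotent_in_compact_add_subsemigroup
    Ultrafilter.continuous_add_left ((· + P) '' V) (hVn.image _)
    (hVc.isCompact.image (Ultrafilter.continuous_add_left P)) (by
      rintro _ ⟨x, hx, rfl⟩ _ ⟨y, hy, rfl⟩
      exact ⟨x + P + y, hVl _ _ hy, add_assoc _ _ _⟩)
  have hve : v + P = e := hve
  have heP : e + P = e := by rw [← hve, add_assoc, hPP]
  have heV : e ∈ V := hve ▸ hVr _ hv _
  have hqq : (P + e) + (P + e) = P + e := by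
    rw [add_assoc, ← add_assoc e, heP, hee]
  have hqV : P + e ∈ V := hVl _ _ heV
  refine ⟨p, P + e, hqq, by simpa only [V, Set.mem_ofPred_eq] using hqV, fun s => ?_⟩
  have hf : ∀ x y : ℕ × ℕ, (fun t : ℕ × ℕ => t.1 + s * t.2) (x + y) =
      (fun t : ℕ × ℕ => t.1 + s * t.2) x + (fun t : ℕ × ℕ => t.1 + s * t.2) y := by
    intro x y; simp only [Prod.fst_add, Prod.snd_add]; ring
  have hfP : P.map (fun t : ℕ × ℕ => t.1 + s * t.2) = p := by
    simp only [P, Ultrafilter.map_map]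
    convert Ultrafilter.map_id p using 2
    funext a; simp
  apply hmin
  · rw [← aph_map_add _ hf, hqq]
  · have h := aph_map_add (fun t : ℕ × ℕ => t.1 + s * t.2) hf (P + e) P
    rw [hfP, add_assoc, heP] at h
    exact h.symm
  · have h := aph_map_add (fun t : ℕ × ℕ => t.1 + s * t.2) hf P (P + e)
    rw [hfP, ← add_assoc, hPP] at h
    exact h.symm

theorem aph_stream (c l : ℕ) (col : ℕ → Fin c) :
    ∃ (γ : Fin c) (t : ℕ → ℕ × ℕ), ∀ C : Finset ℕ, C.Nonempty →
      0 < (∑ i ∈ C, t i).1 ∧ 0 < (∑ i ∈ C, t i).2 ∧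
      ∀ s < l, col ((∑ i ∈ C, t i).1 + s * (∑ i ∈ C, t i).2) = γ := by
  obtain ⟨p, q, hqq, hqV, hq⟩ := aph_exists_q
  obtain ⟨γ, hγ⟩ := Ultrafilter.eq_pure_of_finite (p.map col)
  have hγ' : ∀ᶠ x in p, col x = γ := by
    have : ∀ᶠ y in ((p.map col : Ultrafilter (Fin c)) : Filter (Fin c)), y = γ := by
      rw [hγ]; simp
    simpa using this
  have h : ∀ s, ∀ᶠ t : ℕ × ℕ in q, col (t.1 + s * t.2) = γ := by
    intro s
    rw [← hq s] at hγ'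
    simpa using hγ'
  have h2 : ∀ᶠ t : ℕ × ℕ in q, ∀ s ∈ Finset.range l, col (t.1 + s * t.2) = γ :=
    (Finset.eventually_all _).2 fun s _ => h s
  obtain ⟨a, ha⟩ := Hindman.exists_FS_of_large q hqq _ (hqV.and h2)
  refine ⟨γ, a.get, fun C hC => ?_⟩
  obtain ⟨⟨h1, h2⟩, h3⟩ := ha (Hindman.FS.finsetSum a C hC)
  exact ⟨h1, h2, fun s hs => h3 s (Finset.mem_range.2 hs)⟩

end APHelpers


/-- An `l`-term arithmetic progression is given by its first term `a ≥ 1` and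
common difference `d ≥ 1`; its `s`-th term (`1 ≤ s ≤ l`) is `a + (s-1)*d`.

Two-fold generalization of van der Waerden's and Hindman's theorems:
for any `c`-coloring of the positive integers there are `l`-term arithmetic
progressions `Q₁ ≺ Q₂ ≺ ⋯` all of whose finite pointwise sums are
monochromatic (termwise) with a single color `γ`. -/
theorem finite_sums_of_APs_monochromatic (c l : ℕ) (hc : 0 < c) (hl : 3 ≤ l)
    (col : ℕ → Fin c) :
    ∃ a d : ℕ → ℕ,
      (∀ i, 0 < a i) ∧ (∀ i, 0 < d i) ∧
      -- (i) Q₁ ≺ Q₂ ≺ Q₃ ≺ ⋯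
      (∀ i, ∀ s, 1 ≤ s → s ≤ l →
        a i + (s - 1) * d i < a (i + 1) + (s - 1) * d (i + 1)) ∧
      -- (ii) all terms of all finite pointwise sums have color γ
      (∃ γ : Fin c, ∀ C : Finset ℕ, C.Nonempty → ∀ s, 1 ≤ s → s ≤ l →
        col (∑ i ∈ C, (a i + (s - 1) * d i)) = γ) := by


  obtain ⟨γ, t, ht⟩ := aph_stream c l col
  have ht1 : ∀ i, 1 ≤ (t i).1 ∧ 1 ≤ (t i).2 := fun i => by
    have := ht {i} (Finset.singleton_nonempty i)
    simp only [Finset.sum_singleton] at this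
    exact ⟨this.1, this.2.1⟩
  let S : ℕ → ℕ := fun n => ∑ j ∈ Finset.range n, ((t j).1 + (t j).2)
  let n : ℕ → ℕ := fun i => Nat.rec 0 (fun _ m => m + S m + 1) i
  have hn : ∀ i, n (i + 1) = n i + S (n i) + 1 := fun i => rfl
  have hmono : Monotone n := monotone_nat_of_le_succ fun i => by rw [hn]; omega
  let B : ℕ → Finset ℕ := fun i => Finset.Ico (n i) (n (i + 1))
  have hBn : ∀ i, (B i).Nonempty := fun i => by
    rw [Finset.nonempty_Ico, hn]; omega
  have hdisj : ∀ C : Finset ℕ, Set.PairwiseDisjoint (C : Set ℕ) B := by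
    intro C i _ j _ hij
    rw [Function.onFun, Finset.disjoint_left]
    intro x hx hy
    simp only [B, Finset.mem_Ico] at hx hy
    rcases lt_or_gt_of_ne hij with h | h
    · have := hmono (Nat.succ_le_of_lt h); simp only [Nat.succ_eq_add_one] at this; omega
    · have := hmono (Nat.succ_le_of_lt h); simp only [Nat.succ_eq_add_one] at this; omega
  have hup : ∀ i, (∑ j ∈ B i, t j).1 + (∑ j ∈ B i, t j).2 ≤ S (n (i + 1)) := by
    intro i
    rw [Prod.fst_sum, Prod.snd_sum, ← Finset.sum_add_distrib]
    apply Finset.sum_le_sum_of_subset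
    intro x hx
    simp only [B, Finset.mem_Ico] at hx
    exact Finset.mem_range.2 hx.2
  have hcard : ∀ i, (B i).card = S (n i) + 1 := fun i => by
    simp only [B, Nat.card_Ico, hn]; omega
  have hlo1 : ∀ i, S (n i) + 1 ≤ (∑ j ∈ B i, t j).1 := by
    intro i
    rw [Prod.fst_sum, ← hcard, Finset.card_eq_sum_ones]
    exact Finset.sum_le_sum fun j _ => (ht1 j).1
  have hlo2 : ∀ i, S (n i) + 1 ≤ (∑ j ∈ B i, t j).2 := by
    intro i
    rw [Prod.snd_sum, ← hcard, Finset.card_eq_sum_ones]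
    exact Finset.sum_le_sum fun j _ => (ht1 j).2
  refine ⟨fun i => (∑ j ∈ B i, t j).1, fun i => (∑ j ∈ B i, t j).2,
    fun i => (ht _ (hBn i)).1, fun i => (ht _ (hBn i)).2.1, ?_, γ, ?_⟩
  · intro i s _ _
    have h1 := hup i
    have h2 := hlo1 (i + 1)
    have h3 := hlo2 (i + 1)
    dsimp only
    exact add_lt_add_of_lt_of_le (by omega) (Nat.mul_le_mul_left _ (by omega))
  · intro C hC s hs1 hsl
    have hne : (C.biUnion B).Nonempty := by
      obtain ⟨i, hi⟩ := hC
      obtain ⟨x, hx⟩ := hBn i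
      exact ⟨x, Finset.mem_biUnion.2 ⟨i, hi, hx⟩⟩
    have := (ht _ hne).2.2 (s - 1) (by omega)
    rw [Finset.sum_biUnion (hdisj C), Prod.fst_sum, Prod.snd_sum] at this
    rw [Finset.sum_add_distrib, ← Finset.mul_sum]
    exact this
end

section
/- Let c be a positive integer and l ≥ 3 a positive integer, and let 𝐜 : ℕ → [c] be a c-coloring of the positive integers. Then there exist l-term arithmetic progressions Q₁, Q₂, Q₃, … (each with positive common difference) such that (i) Q₁ ≺ Q₂ ≺ Q₃ ≺ ⋯, and (ii) there is a color γ ∈ [c] such that for every nonempty finite set C of indices and every s ∈ {1, …, l}, both the s-th term of ⊕_{i∈C} Q_i and the common difference of ⊕_{i∈C} Q_i have color γ, i.e. 𝐜(∑_{i∈C} Q_i[s]) = γ and 𝐜(∑_{i∈C} d_i) = γ, where d_i is the common difference of Q_i. -/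
open Filter

attribute [local instance] Ultrafilter.add Ultrafilter.addSemigroup

theorem uf_map_add {M N : Type} [AddCommMonoid M] [AddCommMonoid N] (f : M →+ N)
    (U V : Ultrafilter M) :
    Ultrafilter.map f (U + V) = Ultrafilter.map f U + Ultrafilter.map f V := by
  apply Ultrafilter.coe_inj.mp
  apply Filter.ext'
  intro p
  rw [Ultrafilter.eventually_add]
  simp only [Ultrafilter.coe_map, Filter.eventually_map]
  rw [Ultrafilter.eventually_add]
  simp only [map_add]

/-- there is an idempotent in a minimal left ideal -/
theorem exists_min_idem : ∃ p : Ultrafilter ℕ, p + p = p ∧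
    ∀ x : Ultrafilter ℕ, ∃ y : Ultrafilter ℕ, y + (x + p) = p := by
  let S : Set (Set (Ultrafilter ℕ)) :=
    { N | IsClosed N ∧ N.Nonempty ∧ ∀ (x) (m) (_ : m ∈ N), x + m ∈ N }
  rsuffices ⟨N, hN⟩ : ∃ N', Minimal (· ∈ S) N'
  · obtain ⟨N_closed, N_ne, N_add⟩ := hN.prop
    obtain ⟨p, hp, hpp⟩ := exists_idempotent_in_compact_add_subsemigroup
      (Ultrafilter.continuous_add_left (M := ℕ)) N N_ne N_closed.isCompact
      (fun x _ y hy => N_add x y hy)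
    refine ⟨p, hpp, fun x => ?_⟩
    have h : Set.range (· + (x + p)) = N := by
      apply hN.eq_of_subset
      · refine ⟨(isCompact_range (Ultrafilter.continuous_add_left (x + p))).isClosed,
          ⟨_, ⟨p, rfl⟩⟩, ?_⟩
        rintro z _ ⟨w, rfl⟩
        exact ⟨z + w, add_assoc _ _ _⟩
      · rintro _ ⟨w, rfl⟩
        exact N_add _ _ (N_add _ _ hp)
    rw [← h] at hp
    exact hp
  refine zorn_superset _ fun c hcs hc => ?_
  refine
    ⟨⋂₀ c, ⟨isClosed_sInter fun t ht => (hcs ht).1, ?_, fun x m hm => ?_⟩, fun s hs =>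
      Set.sInter_subset_of_mem hs⟩
  · obtain rfl | hcnemp := c.eq_empty_or_nonempty
    · rw [Set.sInter_empty]
      exact ⟨pure 0, trivial⟩
    convert!
      @IsCompact.nonempty_iInter_of_directed_nonempty_isCompact_isClosed _ _ _ hcnemp.coe_sort
        ((↑) : c → Set (Ultrafilter ℕ)) ?_ ?_ ?_ ?_
    · exact Set.sInter_eq_iInter
    · refine DirectedOn.directed_val (IsChain.directedOn hc.symm)
    exacts [fun i => (hcs i.prop).2.1, fun i => (hcs i.prop).1.isCompact, fun i => (hcs i.prop).1]
  · rw [Set.mem_sInter]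
    exact fun t ht => (hcs ht).2.2 x m (Set.mem_sInter.mp hm t ht)

def fS (s : ℕ) : ℕ × ℕ →+ ℕ where
  toFun x := x.1 + s * x.2
  map_zero' := by simp
  map_add' x y := by simp only [Prod.fst_add, Prod.snd_add]; ring

theorem exists_W : ∃ (p : Ultrafilter ℕ) (W : Ultrafilter (ℕ × ℕ)),
    (∀ n, ∀ᶠ m in (p : Filter ℕ), n ≤ m) ∧ W + W = W ∧
    Ultrafilter.map (Prod.snd) W = p ∧ ∀ s, Ultrafilter.map (fS s) W = p := by
  obtain ⟨p, hpp, hmin⟩ := exists_min_idem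
  let sn : ℕ × ℕ →+ ℕ := AddMonoidHom.snd ℕ ℕ
  let iD : ℕ →+ ℕ × ℕ := AddMonoidHom.inl ℕ ℕ
  let D := Ultrafilter.map iD p
  have hDD : D + D = D := by
    change Ultrafilter.map iD p + Ultrafilter.map iD p = _
    rw [← uf_map_add, hpp]
  have h0 : Ultrafilter.map sn D = pure 0 := by
    change Ultrafilter.map sn (Ultrafilter.map iD p) = _
    rw [Ultrafilter.map_map]
    apply Ultrafilter.coe_inj.mp
    apply Filter.ext'
    intro q
    simp [sn, iD]
  have hfD : ∀ s, Ultrafilter.map (fS s) D = p := by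
    intro s
    change Ultrafilter.map (fS s) (Ultrafilter.map iD p) = _
    rw [Ultrafilter.map_map]
    apply Ultrafilter.coe_inj.mp
    apply Filter.ext'
    intro q
    simp [fS, iD]
  have z1 : ∀ x : Ultrafilter ℕ, pure 0 + x = x := by
    intro x
    apply Ultrafilter.coe_inj.mp
    apply Filter.ext'
    intro q
    rw [Ultrafilter.eventually_add]
    simp
  have z2 : ∀ x : Ultrafilter ℕ, x + pure 0 = x := by
    intro x
    apply Ultrafilter.coe_inj.mp
    apply Filter.ext'
    intro q
    rw [Ultrafilter.eventually_add]
    simp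
  let J : Set (Ultrafilter (ℕ × ℕ)) := {W | Ultrafilter.map sn W = p}
  have hJc : IsClosed J := by
    have : J = ⋂ A ∈ {A : Set ℕ | A ∈ p}, {W : Ultrafilter (ℕ × ℕ) | sn ⁻¹' A ∈ W} := by
      ext W
      simp only [J, Set.mem_iInter, Set.mem_ofPred_eq]
      constructor
      · rintro h A hA
        rw [← h] at hA
        exact hA
      · intro h
        apply Ultrafilter.coe_le_coe.mp
        intro A hA
        exact h A hA
    rw [this]
    exact isClosed_biInter fun A _ => ultrafilter_isClosed_basic _
  have hJn : (Ultrafilter.map (AddMonoidHom.inr ℕ ℕ) p) ∈ J := by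
    change Ultrafilter.map sn _ = p
    rw [Ultrafilter.map_map]
    apply Ultrafilter.coe_inj.mp
    apply Filter.ext'
    intro q
    simp [sn]
  have hJD : ∀ j ∈ J, j + D ∈ J := by
    intro j hj
    change Ultrafilter.map sn _ = p
    rw [uf_map_add, h0, z2]; exact hj
  have hDJ : ∀ j ∈ J, D + j ∈ J := by
    intro j hj
    change Ultrafilter.map sn _ = p
    rw [uf_map_add, h0, z1]; exact hj
  have hJJ : ∀ j ∈ J, ∀ k ∈ J, j + k ∈ J := by
    intro j hj k hk
    change Ultrafilter.map sn _ = p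
    rw [uf_map_add, show Ultrafilter.map sn j = p from hj, show Ultrafilter.map sn k = p from hk, hpp]
  obtain ⟨e, ⟨j, hj, rfl⟩, hee⟩ := exists_idempotent_in_compact_add_subsemigroup
      (Ultrafilter.continuous_add_left (M := ℕ × ℕ)) ((· + D) '' J) ⟨_, _, hJn, rfl⟩
      (hJc.isCompact.image (Ultrafilter.continuous_add_left D)) (by
        rintro _ ⟨x, hx, rfl⟩ _ ⟨y, hy, rfl⟩
        exact ⟨x + D + y, hJJ _ (hJD _ hx) _ hy, add_assoc _ _ _⟩)
  simp only at hee
  have heD : j + D + D = j + D := by rw [add_assoc, hDD]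
  refine ⟨p, D + (j + D), ?_, ?_, hDJ _ (hJD _ hj), ?_⟩
  · intro n
    obtain ⟨y, hy⟩ := hmin (pure n)
    rw [← hy, Ultrafilter.eventually_add]
    refine Eventually.of_forall fun a => ?_
    rw [Ultrafilter.eventually_add]
    simp only [Ultrafilter.coe_pure, Filter.eventually_pure]
    exact Eventually.of_forall fun b => by omega
  · calc D + (j + D) + (D + (j + D)) = D + ((j + D + D) + (j + D)) := by simp only [add_assoc]
      _ = _ := by rw [heD, hee]
  · intro s
    have h1 : Ultrafilter.map (fS s) (j + D) = Ultrafilter.map (fS s) j + p := by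
      rw [uf_map_add, hfD]
    obtain ⟨y, hy⟩ := hmin (Ultrafilter.map (fS s) j)
    rw [uf_map_add, hfD]
    have h2 : Ultrafilter.map (fS s) (j + D) + Ultrafilter.map (fS s) (j + D)
      = Ultrafilter.map (fS s) (j + D) := by rw [← uf_map_add, hee]
    rw [← h1] at hy
    calc p + Ultrafilter.map (fS s) (j + D)
        = y + Ultrafilter.map (fS s) (j + D) + Ultrafilter.map (fS s) (j + D) := by rw [hy]
      _ = p := by rw [add_assoc, h2, hy]

theorem exists_seq_of_idem {M : Type} [AddCommMonoid M] (W : Ultrafilter M) (hW : W + W = W)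
    (S : Set M) (hS : S ∈ W) (R : M → M → Prop) (hR : ∀ m, ∀ᶠ m' in (W : Filter M), R m m') :
    ∃ x : ℕ → M, (∀ n, R (x n) (x (n + 1))) ∧
      ∀ C : Finset ℕ, C.Nonempty → ∑ i ∈ C, x i ∈ S := by
  have ex : ∀ p : {s // s ∈ W}, (p.1 ∩ { m | ∀ᶠ m' in (W : Filter M), m + m' ∈ p.1 }).Nonempty :=
    fun ⟨s, hs⟩ => Ultrafilter.nonempty_of_mem (inter_mem hs <| by rwa [← hW] at hs)
  choose el hel using ex
  let succ : {s // s ∈ W} → {s // s ∈ W} := fun p =>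
    ⟨p.1 ∩ ({m | el p + m ∈ p.1} ∩ {m | R (el p) m}),
      inter_mem p.2 (inter_mem (hel p).2 (hR _))⟩
  let T : ℕ → {s // s ∈ W} := fun n => Nat.rec ⟨S, hS⟩ (fun _ p => succ p) n
  have hT : ∀ n, T (n + 1) = succ (T n) := fun n => rfl
  have hanti : Antitone fun n => (T n).1 :=
    antitone_nat_of_succ_le fun n => by rw [hT]; exact Set.inter_subset_left
  refine ⟨fun n => el (T n), fun n => ?_, ?_⟩
  · have := (hel (T (n + 1))).1
    rw [hT] at this
    exact this.2.2
  · have key : ∀ (k : ℕ) (C : Finset ℕ) (n : ℕ), C.card = k → C.Nonempty → (∀ i ∈ C, n ≤ i) →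
        ∑ i ∈ C, el (T i) ∈ (T n).1 := by
      intro k
      induction k with
      | zero => intro C n h hC; simp at h; simp [h] at hC
      | succ k ih =>
        intro C n h hC hn
        have hm := C.min'_mem hC
        rw [← Finset.add_sum_erase _ _ hm]
        apply hanti (hn _ hm)
        rcases (C.erase (C.min' hC)).eq_empty_or_nonempty with h' | h'
        · rw [h', Finset.sum_empty, add_zero]
          exact (hel _).1
        · have := ih (C.erase (C.min' hC)) (C.min' hC + 1)
            (by rw [Finset.card_erase_of_mem hm]; omega) h'
            (fun i hi => Finset.min'_lt_of_mem_erase_min' _ _ hi)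
          rw [hT] at this
          exact this.2.1
    intro C hC
    exact key _ C 0 rfl hC (fun _ _ => Nat.zero_le _)


/-- Two-fold generalization of van der Waerden–Brauer's and Hindman's theorems:
for any `c`-coloring of the positive integers there are `l`-term arithmetic
progressions `Q₁ ≺ Q₂ ≺ ⋯` (first term `a i`, common difference `d i`) such
that all terms of all finite pointwise sums, as well as the common differences
of those finite sums, have a single color `γ`. -/
theorem finite_sums_of_APs_monochromatic_with_differences (c l : ℕ)
    (hc : 0 < c) (hl : 3 ≤ l) (col : ℕ → Fin c) :
    ∃ a d : ℕ → ℕ,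
      (∀ i, 0 < a i) ∧ (∀ i, 0 < d i) ∧
      -- (i) Q₁ ≺ Q₂ ≺ Q₃ ≺ ⋯
      (∀ i, ∀ s, 1 ≤ s → s ≤ l →
        a i + (s - 1) * d i < a (i + 1) + (s - 1) * d (i + 1)) ∧
      -- (ii) all terms and all common differences of finite pointwise sums
      -- have color γ
      (∃ γ : Fin c, ∀ C : Finset ℕ, C.Nonempty →
        ((∀ s, 1 ≤ s → s ≤ l → col (∑ i ∈ C, (a i + (s - 1) * d i)) = γ) ∧
          col (∑ i ∈ C, d i) = γ)) := by
  obtain ⟨p, W, hp, hW, hsn, hf⟩ := exists_W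
  obtain ⟨γ, hγ⟩ : ∃ γ : Fin c, ∀ᶠ m in (p : Filter ℕ), col m = γ := by
    have h : ∀ᶠ m in (p : Filter ℕ), ∃ γ : Fin c, col m = γ := Eventually.of_forall fun m => ⟨_, rfl⟩
    exact Ultrafilter.eventually_exists_iff.mp h
  have hd : ∀ q : ℕ → Prop, (∀ᶠ m in (p : Filter ℕ), q m) → ∀ᶠ x in (W : Filter (ℕ × ℕ)), q x.2 := by
    intro q hq
    rw [← hsn] at hq
    exact hq
  have hs : ∀ s, ∀ q : ℕ → Prop, (∀ᶠ m in (p : Filter ℕ), q m) →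
      ∀ᶠ x in (W : Filter (ℕ × ℕ)), q (x.1 + s * x.2) := by
    intro s q hq
    rw [← hf s] at hq
    exact hq
  have hall : ∀ᶠ x in (W : Filter (ℕ × ℕ)), (0 < x.1 ∧ 0 < x.2 ∧ col x.2 = γ) ∧
      ∀ s ∈ Finset.range l, col (x.1 + s * x.2) = γ := by
    refine Filter.Eventually.and ?_ ?_
    · filter_upwards [hd _ (hp 1), hs 0 _ (hp 1), hd _ hγ] with x h1 h2 h3
      exact ⟨by omega, by omega, h3⟩
    · rw [Filter.eventually_all_finset]
      intro s _
      exact hs s _ hγ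
  obtain ⟨x, hx1, hx2⟩ := exists_seq_of_idem W hW _ hall
    (fun m m' => m.1 + l * m.2 + 1 ≤ m'.1) (fun m => by
      filter_upwards [hs 0 _ (hp (m.1 + l * m.2 + 1))] with y hy
      simpa using hy)
  have hsing : ∀ i, 0 < (x i).1 ∧ 0 < (x i).2 := by
    intro i
    have := hx2 {i} (Finset.singleton_nonempty i)
    simp only [Finset.sum_singleton] at this
    exact ⟨this.1.1, this.1.2.1⟩
  refine ⟨fun i => (x i).1, fun i => (x i).2, fun i => (hsing i).1, fun i => (hsing i).2, ?_, γ, ?_⟩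
  · intro i s _ h2
    have h3 := hx1 i
    have h4 : (s - 1) * (x i).2 ≤ l * (x i).2 := Nat.mul_le_mul_right _ (by omega)
    have h5 := Nat.zero_le ((s - 1) * (x (i + 1)).2)
    simp only at h3 ⊢
    omega
  · intro C hC
    obtain ⟨⟨_, _, h3⟩, h4⟩ := hx2 C hC
    rw [Prod.snd_sum] at h3
    refine ⟨fun s h1 h2 => ?_, h3⟩
    have := h4 (s - 1) (Finset.mem_range.mpr (by omega))
    rw [Prod.snd_sum, Prod.fst_sum] at this
    rw [Finset.sum_add_distrib, ← Finset.mul_sum]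
    exact this
end

section
/- For all positive integers c, n and all l ≥ 3, there exists a positive integer m such that whenever {1, 2, …, m} is c-colored, there exist l-term arithmetic progressions Q₁, Q₂, …, Q_n contained in {1, 2, …, m} with Q₁ ≺ Q₂ ≺ ⋯ ≺ Q_n, such that ∑_{i=1}^{n} Q_i[l] ≤ m, and there is a color γ such that for every nonempty subset C of {1, …, n} and every s ∈ {1, …, l}, the s-th term ∑_{i∈C} Q_i[s] of the pointwise sum ⊕_{i∈C} Q_i has color γ. -/
theorem vdw_fin (c K : ℕ) : ∃ W : ℕ, ∀ col : ℕ → Fin c, ∃ a D : ℕ, 0 < a ∧ 0 < D ∧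
    a + K * D ≤ W ∧ ∃ γ : Fin c, ∀ k ≤ K, col (a + k * D) = γ := by
  classical
  obtain ⟨ι, _, hι⟩ := Combinatorics.Line.exists_mono_in_high_dimension (Fin (K+1)) (Fin c)
  refine ⟨1 + Fintype.card ι * K, fun col => ?_⟩
  obtain ⟨L, γ, hL⟩ := hι (fun v => col (1 + ∑ i, (v i : ℕ)))
  set D := (Finset.univ.filter (fun i => L.idxFun i = none)).card with hD
  set b := ∑ i, ((L.idxFun i).elim 0 (fun x => (x : ℕ))) with hb
  have key : ∀ x : Fin (K+1), ∑ i, (L x i : ℕ) = b + x * D := by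
    intro x
    rw [hb, hD, Finset.card_filter, Finset.mul_sum, ← Finset.sum_add_distrib]
    refine Finset.sum_congr rfl fun i _ => ?_
    rw [Combinatorics.Line.coe_apply]
    cases h : L.idxFun i <;> simp
  have key' : ∀ k ≤ K, ∑ i, (L (Fin.ofNat (K+1) k) i : ℕ) = b + k * D := by
    intro k hk
    rw [key]
    simp [Nat.mod_eq_of_lt (Nat.lt_succ_of_le hk)]
  refine ⟨1 + b, D, by omega, ?_, ?_, γ, ?_⟩
  · obtain ⟨i, hi⟩ := L.proper
    exact Finset.card_pos.2 ⟨i, by simp [hi]⟩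
  · have := key' K le_rfl
    have h2 : ∑ i, (L (Fin.ofNat (K+1) K) i : ℕ) ≤ Fintype.card ι * K := by
      refine (Finset.sum_le_card_nsmul _ _ K fun i _ => ?_).trans (by simp)
      exact Nat.le_of_lt_succ (L (Fin.ofNat (K+1) K) i).2
    omega
  · intro k hk
    have := hL (Fin.ofNat (K+1) k)
    beta_reduce at this
    rw [key' k hk] at this
    rwa [add_assoc]

theorem max_colored (c l : ℕ) (hc : 0 < c) (N : ℕ) : ∃ M : ℕ, ∀ col : ℕ → Fin c,
    ∃ (a d : ℕ → ℕ) (f : ℕ → Fin c),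
      (∀ i < N, 0 < a i) ∧ (∀ i < N, 0 < d i) ∧
      (∀ i j, i < j → j < N → ∀ t ≤ l, a i + t * d i < a j + t * d j) ∧
      (∑ i ∈ Finset.range N, (a i + l * d i) ≤ M) ∧
      (∀ i < N, ∀ C ⊆ Finset.range i, ∀ t ≤ l,
        col (a i + t * d i + ∑ j ∈ C, (a j + t * d j)) = f i) := by
  induction N with
  | zero => exact ⟨0, fun col => ⟨fun _ => 0, fun _ => 0, fun _ => ⟨0, hc⟩, by simp⟩⟩
  | succ N ih =>
    obtain ⟨M, hM⟩ := ih
    obtain ⟨W, hW⟩ := vdw_fin c (2 * M + l)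
    refine ⟨W, fun col => ?_⟩
    obtain ⟨a0, D, ha0, hD, hle, γ, hγ⟩ := hW col
    obtain ⟨a, d, f, ha, hd, hord, hsum, hf⟩ := hM (fun x => col (D * x))
    have hS : ∀ C ⊆ Finset.range N, ∀ t ≤ l, ∑ j ∈ C, (a j + t * d j) ≤ M := by
      intro C hC t ht
      refine le_trans ?_ hsum
      refine (Finset.sum_le_sum fun j _ => ?_).trans (Finset.sum_le_sum_of_subset hC)
      gcongr
    let a' := fun i => if i < N then D * a i else a0 + D * M
    let d' := fun i => if i < N then D * d i else D
    have hlt : ∀ i < N, ∀ t, a' i + t * d' i = D * (a i + t * d i) := by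
      intro i hi t
      simp only [a', d', hi, if_true]; ring
    have hN : ∀ t, a' N + t * d' N = a0 + (M + t) * D := by
      intro t
      simp only [a', d', lt_irrefl, if_false]; ring
    have hC' : ∀ C ⊆ Finset.range N, ∀ t,
        ∑ j ∈ C, (a' j + t * d' j) = D * ∑ j ∈ C, (a j + t * d j) := by
      intro C hC t
      rw [Finset.mul_sum]
      exact Finset.sum_congr rfl fun j hj => hlt j (Finset.mem_range.1 (hC hj)) t
    refine ⟨a', d', fun i => if i < N then f i else γ, ?_, ?_, ?_, ?_, ?_⟩
    · intro i hi
      by_cases h : i < N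
      · simp only [a', h, if_true]; exact Nat.mul_pos hD (ha i h)
      · simp only [a', h, if_false]; omega
    · intro i hi
      by_cases h : i < N
      · simp only [d', h, if_true]; exact Nat.mul_pos hD (hd i h)
      · simp only [d', h, if_false]; omega
    · intro i j hij hj t ht
      by_cases h : j < N
      · rw [hlt i (hij.trans h), hlt j h]
        exact Nat.mul_lt_mul_of_pos_left (hord i j hij h t ht) hD
      · obtain rfl : j = N := by omega
        rw [hlt i hij, hN]
        have := hS {i} (by simpa using hij) t ht
        rw [Finset.sum_singleton] at this
        have := Nat.mul_le_mul_left D this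
        nlinarith [Nat.zero_le (t * D)]
    · rw [Finset.sum_range_succ, hC' _ subset_rfl, hN]
      have := Nat.mul_le_mul_left D hsum
      nlinarith
    · intro i hi C hC t ht
      by_cases h : i < N
      · have hCN : C ⊆ Finset.range N := hC.trans (Finset.range_subset_range.2 h.le)
        rw [hlt i h, hC' C hCN, ← mul_add]
        simp only [h, if_true]
        exact hf i h C hC t ht
      · obtain rfl : i = N := by omega
        rw [hN, hC' C hC]
        simp only [lt_irrefl, if_false]
        have h1 := hS C hC t ht
        rw [← hγ (M + t + ∑ j ∈ C, (a j + t * d j)) (by omega)]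
        congr 1; ring

/-- Finite version: for positive integers `c`, `n` and `l ≥ 3` there is `m`
such that every `c`-coloring of `{1,…,m}` admits `l`-term arithmetic
progressions `Q₁ ≺ ⋯ ≺ Q_n` contained in `{1,…,m}` with `∑ᵢ Qᵢ[l] ≤ m`,
all of whose finite pointwise sums are termwise monochromatic. -/
theorem finite_sums_of_APs_finitary (c n l : ℕ) (hc : 0 < c) (hn : 0 < n)
    (hl : 3 ≤ l) :
    ∃ m : ℕ, 0 < m ∧ ∀ col : ℕ → Fin c,
      ∃ a d : Fin n → ℕ,
        (∀ i, 0 < a i) ∧ (∀ i, 0 < d i) ∧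
        -- Q₁ ≺ Q₂ ≺ ⋯ ≺ Q_n
        (∀ i j : Fin n, i < j → ∀ s, 1 ≤ s → s ≤ l →
          a i + (s - 1) * d i < a j + (s - 1) * d j) ∧
        -- each Qᵢ ⊆ {1,…,m}
        (∀ i : Fin n, ∀ s, 1 ≤ s → s ≤ l → a i + (s - 1) * d i ≤ m) ∧
        -- ∑ᵢ Qᵢ[l] ≤ m
        (∑ i, (a i + (l - 1) * d i)) ≤ m ∧
        -- all finite pointwise sums are termwise monochromatic
        (∃ γ : Fin c, ∀ C : Finset (Fin n), C.Nonempty → ∀ s, 1 ≤ s → s ≤ l →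
          col (∑ i ∈ C, (a i + (s - 1) * d i)) = γ) := by
  classical
  obtain ⟨M, hM⟩ := max_colored c l hc (c * n)
  refine ⟨M + 1, by omega, fun col => ?_⟩
  obtain ⟨a, d, f, ha, hd, hord, hsum, hf⟩ := hM col
  have : Nonempty (Fin c) := ⟨⟨0, hc⟩⟩
  obtain ⟨γ, -, hγ⟩ := Finset.exists_le_card_fiber_of_mul_le_card_of_maps_to
    (s := Finset.range (c * n)) (t := (Finset.univ : Finset (Fin c))) (f := f) (n := n)
    (fun _ _ => Finset.mem_univ _) Finset.univ_nonempty (by simp)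
  obtain ⟨T, hT, hTc⟩ := Finset.exists_subset_card_eq hγ
  let e := T.orderEmbOfFin hTc
  have he : ∀ i, e i < c * n ∧ f (e i) = γ := by
    intro i
    have := hT (T.orderEmbOfFin_mem hTc i)
    simpa using this
  have hmap : ∀ (C : Finset (Fin n)) (t : ℕ), ∑ i ∈ C, (a (e i) + t * d (e i)) =
      ∑ j ∈ C.map e.toEmbedding, (a j + t * d j) := by
    intro C t
    rw [Finset.sum_map]
    rfl
  have hs1 : ∑ i, (a (e i) + l * d (e i)) ≤ M := by
    refine le_trans ?_ hsum
    rw [hmap]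
    apply Finset.sum_le_sum_of_subset
    intro x hx
    obtain ⟨i, -, rfl⟩ := Finset.mem_map.1 hx
    exact Finset.mem_range.2 (he i).1
  refine ⟨fun i => a (e i), fun i => d (e i), fun i => ha _ (he i).1, fun i => hd _ (he i).1,
    ?_, ?_, ?_, γ, ?_⟩
  · intro i j hij s _ hs
    exact hord _ _ (e.lt_iff_lt.2 hij) (he j).1 _ (by omega)
  · intro i s _ hs
    have h1 := Finset.single_le_sum (f := fun i => a (e i) + l * d (e i))
      (fun _ _ => Nat.zero_le _) (Finset.mem_univ i)
    have h2 : (s - 1) * d (e i) ≤ l * d (e i) := Nat.mul_le_mul_right _ (by omega)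
    simp only at h1 ⊢
    omega
  · refine le_trans (Finset.sum_le_sum fun i _ => ?_) (hs1.trans (Nat.le_succ _))
    exact Nat.add_le_add_left (Nat.mul_le_mul_right _ (by omega)) _
  · intro C hC s _ hs
    have hm := C.max'_mem hC
    beta_reduce
    rw [← Finset.add_sum_erase C _ hm, hmap, ← (he (C.max' hC)).2]
    refine hf _ (he _).1 _ ?_ _ (by omega)
    intro x hx
    obtain ⟨i, hi, rfl⟩ := Finset.mem_map.1 hx
    exact Finset.mem_range.2 (e.lt_iff_lt.2 (C.lt_max'_of_mem_erase_max' hC hi))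
end

section
/- Let m and q be positive integers, and for 1 ≤ i ≤ m set h_i = (m + i) + (i − 1)q and define the q-term arithmetic progression P_i with s-th term P_i[s] = 2^i + (s − 1)·2^{h_i} for 1 ≤ s ≤ q. Then for each fixed s ∈ {1, …, q}, the positive integers P₁[s], P₂[s], …, P_m[s] are pairwise power-disjoint. -/
/-- Two positive integers are power-disjoint if the sets of exponents in their
binary expansions are disjoint. -/
def PowerDisjoint (a b : ℕ) : Prop := ∀ k, a.testBit k → b.testBit k → False

theorem bit_aux (i h x q k : ℕ) (hih : i < h) (hx : x < q)
    (hk : (2 ^ i + x * 2 ^ h).testBit k = true) : k = i ∨ (h ≤ k ∧ k < h + q) := by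
  have hlt : 2 ^ i < 2 ^ h := Nat.pow_lt_pow_right (by norm_num) hih
  rw [add_comm, mul_comm, Nat.testBit_two_pow_mul_add _ hlt] at hk
  split_ifs at hk with hc
  · left
    rw [Nat.testBit_two_pow] at hk
    simpa using (of_decide_eq_true hk).symm
  · right
    refine ⟨by omega, ?_⟩
    by_contra hcon
    have h1 : x < 2 ^ (k - h) :=
      lt_of_lt_of_le (hx.trans Nat.lt_two_pow_self) (Nat.pow_le_pow_right (by norm_num) (by omega))
    rw [Nat.testBit_lt_two_pow h1] at hk
    exact absurd hk (by simp)

theorem step_aux (m q i j : ℕ) (hi : 1 ≤ i) (hij : i < j) :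
    (m + i) + (i - 1) * q + q < (m + j) + (j - 1) * q := by
  have h : (i - 1 + 1) * q ≤ (j - 1) * q := Nat.mul_le_mul_right q (by omega)
  rw [Nat.add_mul, one_mul] at h
  omega

/-- With `hᵢ = (m + i) + (i − 1)q` and `Pᵢ[s] = 2^i + (s − 1)·2^(hᵢ)`, for each
fixed `s ∈ {1,…,q}` the numbers `P₁[s], …, P_m[s]` are pairwise
power-disjoint. -/
theorem P_terms_pairwise_power_disjoint (m q : ℕ) (hm : 0 < m) (hq : 0 < q) :
    ∀ s, 1 ≤ s → s ≤ q →
      ∀ i j, 1 ≤ i → i ≤ m → 1 ≤ j → j ≤ m → i ≠ j →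
        PowerDisjoint (2 ^ i + (s - 1) * 2 ^ ((m + i) + (i - 1) * q))
          (2 ^ j + (s - 1) * 2 ^ ((m + j) + (j - 1) * q)) := by
  intro s hs hsq i j hi him hj hjm hij k hk1 hk2
  have a := bit_aux i _ (s - 1) q k (by omega) (by omega) hk1
  have b := bit_aux j _ (s - 1) q k (by omega) (by omega) hk2
  rcases lt_or_gt_of_ne hij with h | h
  · have c := step_aux m q i j hi h
    omega
  · have c := step_aux m q j i hj h
    omega
end

section
/- Let n be a positive integer and let a₁ < a₂ < ⋯ be a strictly increasing sequence of positive integers satisfying a_{m+1} > a₁ + a₂ + ⋯ + a_m + m·n for every m ≥ 1. Define the n-term arithmetic progressions P_i = {a_i, a_i + 1, …, a_i + (n − 1)} (common difference 1). Then for all nonempty finite sets C₁ < C₂ of indices, ⊕_{i∈C₁} P_i ≺ ⊕_{i∈C₂} P_i; that is, for every s ∈ {1, …, n}, ∑_{i∈C₁}(a_i + (s − 1)) < ∑_{i∈C₂}(a_i + (s − 1)). -/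
/-- If `a 0 < a 1 < ⋯` are positive integers with each term exceeding the sum
of all previous terms plus (number of previous terms)·n, and
`Pᵢ = {aᵢ, aᵢ + 1, …, aᵢ + (n−1)}`, then for nonempty finite index sets
`C₁ < C₂` we have `⊕_{i∈C₁} Pᵢ ≺ ⊕_{i∈C₂} Pᵢ`. -/
theorem pointwise_sums_ordered (n : ℕ) (hn : 0 < n) (a : ℕ → ℕ)
    (hpos : ∀ i, 0 < a i) (hmono : StrictMono a)
    (hgrow : ∀ m, 1 ≤ m → (∑ i ∈ Finset.range m, a i) + m * n < a m) :
    ∀ C₁ C₂ : Finset ℕ, C₁.Nonempty → C₂.Nonempty →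
      (∀ x ∈ C₁, ∀ y ∈ C₂, x < y) →
      ∀ s, 1 ≤ s → s ≤ n →
        ∑ i ∈ C₁, (a i + (s - 1)) < ∑ i ∈ C₂, (a i + (s - 1)) := by
  intro C₁ C₂ h1 h2 hlt s hs hsn
  obtain ⟨x, hx⟩ := h1
  obtain ⟨m, hm⟩ := h2
  have hxm := hlt x hx m hm
  have hsub : C₁ ⊆ Finset.range m := fun z hz => Finset.mem_range.2 (hlt z hz m hm)
  have e1 : ∑ i ∈ C₁, (a i + (s - 1)) ≤ ∑ i ∈ Finset.range m, (a i + (s - 1)) :=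
    Finset.sum_le_sum_of_subset hsub
  have e2 : ∑ i ∈ Finset.range m, (a i + (s - 1)) = (∑ i ∈ Finset.range m, a i) + m * (s - 1) := by
    simp [Finset.sum_add_distrib]
  have e3 : m * (s - 1) ≤ m * n := Nat.mul_le_mul_left m (by omega)
  have e4 : a m + (s - 1) ≤ ∑ i ∈ C₂, (a i + (s - 1)) :=
    Finset.single_le_sum (f := fun i => a i + (s - 1)) (fun _ _ => Nat.zero_le _) hm
  have e5 := hgrow m (by omega)
  omega
end

section
/- Let c and n be positive integers and let 𝐜 : ℕ → [c] be a c-coloring of the positive integers. Then there exist n-term arithmetic progressions P₁, P₂, P₃, … (each with positive common difference) and colors α₁, …, α_n ∈ [c] such that: (a) for every nonempty finite set C of indices and every s ∈ {1, …, n}, 𝐜(∑_{i∈C} P_i[s]) = α_s; and (b) for all nonempty finite sets C₁ < C₂ of indices, ⊕_{i∈C₁} P_i ≺ ⊕_{i∈C₂} P_i. -/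
/-- Main inductive lemma: for any `c`-coloring of the positive integers there
are `n`-term arithmetic progressions `P₁, P₂, …` (first term `a i`, common
difference `d i`) and colors `α₁, …, α_n` such that (a) the `s`-th term of any
finite pointwise sum has color `α_s`, and (b) the pointwise sums respect the
ordering of index sets: `C₁ < C₂` implies `⊕_{i∈C₁} Pᵢ ≺ ⊕_{i∈C₂} Pᵢ`. -/
theorem progressions_with_termwise_colors (c n : ℕ) (hc : 0 < c) (hn : 0 < n)
    (col : ℕ → Fin c) :
    ∃ a d : ℕ → ℕ, ∃ α : ℕ → Fin c,
      (∀ i, 0 < a i) ∧ (∀ i, 0 < d i) ∧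
      -- (a) the s-th term of every finite pointwise sum has color α s
      (∀ C : Finset ℕ, C.Nonempty → ∀ s, 1 ≤ s → s ≤ n →
        col (∑ i ∈ C, (a i + (s - 1) * d i)) = α s) ∧
      -- (b) C₁ < C₂ implies ⊕_{i∈C₁} Pᵢ ≺ ⊕_{i∈C₂} Pᵢ
      (∀ C₁ C₂ : Finset ℕ, C₁.Nonempty → C₂.Nonempty →
        (∀ x ∈ C₁, ∀ y ∈ C₂, x < y) →
        ∀ s, 1 ≤ s → s ≤ n →
          ∑ i ∈ C₁, (a i + (s - 1) * d i) < ∑ i ∈ C₂, (a i + (s - 1) * d i)) := by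
  classical
  let key : ℕ → (Fin n → Fin c) := fun m s => col ((s.val + 1) * m)
  let S : Set (Set ℕ) := Set.range (fun k : Fin n → Fin c => {m : ℕ | 0 < m ∧ key m = k})
  have hpos : ∀ (a : Stream' ℕ) (m : ℕ), Hindman.FS a m → (∀ i, 0 < a.get i) → 0 < m := by
    intro a m h
    induction h with
    | head' a => intro h; exact h 0
    | tail' a m _ ih => intro h; exact ih (fun i => h (i + 1))
    | cons' a m _ ih => intro h; exact Nat.add_pos_left (h 0) _
  obtain ⟨_, ⟨k, rfl⟩, b, hb⟩ := Hindman.FS_partition_regular (Stream'.const 1) S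
    (Set.finite_range _) (by
      intro m hm
      have h0 : 0 < m := hpos _ m hm (fun i => by simp)
      exact ⟨_, ⟨key m, rfl⟩, h0, rfl⟩)
  have hB : ∀ C : Finset ℕ, C.Nonempty → 0 < ∑ i ∈ C, b.get i ∧ key (∑ i ∈ C, b.get i) = k :=
    fun C hC => hb (Hindman.FS.finsetSum b C hC)
  have hb1 : ∀ i, 1 ≤ b.get i := fun i => by
    have h := (hB {i} (by simp)).1
    rw [Finset.sum_singleton] at h
    exact h
  let t : ℕ → ℕ := fun j => Nat.rec 0 (fun _ x => x + (∑ i ∈ Finset.range x, b.get i) + 1) j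
  have ht0 : t 0 = 0 := rfl
  have ht : ∀ j, t (j + 1) = t j + (∑ i ∈ Finset.range (t j), b.get i) + 1 := fun j => rfl
  clear_value t
  have htm : StrictMono t := strictMono_nat_of_lt_succ (fun j => by rw [ht]; omega)
  let a : ℕ → ℕ := fun j => ∑ i ∈ Finset.Ico (t j) (t (j + 1)), b.get i
  have hbig : ∀ j, ∑ i ∈ Finset.range (t j), b.get i < a j := by
    intro j
    have h1 : (Finset.Ico (t j) (t (j + 1))).card • 1 ≤ a j :=
      Finset.card_nsmul_le_sum _ _ _ (fun i _ => hb1 i)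
    rw [Nat.card_Ico, ht, smul_eq_mul] at h1
    omega
  have hpre : ∀ j, ∑ i ∈ Finset.range j, a i = ∑ i ∈ Finset.range (t j), b.get i := by
    intro j
    induction j with
    | zero => rw [ht0]; rfl
    | succ j ih =>
      rw [Finset.sum_range_succ, ih]
      exact Finset.sum_range_add_sum_Ico _ (htm (Nat.lt_succ_self j)).le
  have ha : ∀ i, 0 < a i := fun i => lt_of_le_of_lt (Nat.zero_le _) (hbig i)
  have hmul : ∀ (C : Finset ℕ) (s : ℕ), 1 ≤ s →
      ∑ i ∈ C, (a i + (s - 1) * a i) = s * ∑ i ∈ C, a i := by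
    intro C s hs
    obtain ⟨r, rfl⟩ := Nat.exists_eq_add_of_le hs
    rw [Finset.mul_sum]
    refine Finset.sum_congr rfl (fun i _ => ?_)
    rw [Nat.add_sub_cancel_left]
    ring
  have hkey : ∀ C : Finset ℕ, C.Nonempty → key (∑ i ∈ C, a i) = k := by
    intro C hC
    have hd : ∑ i ∈ C, a i
        = ∑ i ∈ C.biUnion (fun j => Finset.Ico (t j) (t (j + 1))), b.get i := by
      rw [Finset.sum_biUnion]
      intro x _ y _ hxy
      rw [Function.onFun, Finset.disjoint_left]
      intro z hz hz'
      rw [Finset.mem_Ico] at hz hz'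
      rcases lt_or_gt_of_ne hxy with h | h
      · have := htm.monotone (Nat.succ_le_of_lt h)
        simp only [Nat.succ_eq_add_one] at this
        omega
      · have := htm.monotone (Nat.succ_le_of_lt h)
        simp only [Nat.succ_eq_add_one] at this
        omega
    rw [hd]
    obtain ⟨x, hx⟩ := hC
    have hx1 : t x < t (x + 1) := htm (Nat.lt_succ_self x)
    have hx2 : t x ∈ C.biUnion (fun j => Finset.Ico (t j) (t (j + 1))) := by
      rw [Finset.mem_biUnion]
      refine ⟨x, hx, ?_⟩
      rw [Finset.mem_Ico]
      exact ⟨le_rfl, hx1⟩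
    exact (hB _ ⟨t x, hx2⟩).2
  refine ⟨a, a, fun s => if h : s - 1 < n then k ⟨s - 1, h⟩ else ⟨0, hc⟩, ha, ha, ?_, ?_⟩
  · intro C hC s h1 h2
    have h3 : s - 1 < n := by omega
    rw [hmul C s h1]
    simp only [h3, dif_pos]
    rw [← hkey C hC]
    simp only [key]
    rw [Nat.sub_add_cancel h1]
  · intro C₁ C₂ _ hC₂ hlt s h1 _
    rw [hmul C₁ s h1, hmul C₂ s h1]
    refine Nat.mul_lt_mul_of_pos_left ?_ h1
    obtain ⟨y, hy⟩ := hC₂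
    calc ∑ i ∈ C₁, a i ≤ ∑ i ∈ Finset.range y, a i :=
          Finset.sum_le_sum_of_subset (fun x hx => Finset.mem_range.2 (hlt x hx y hy))
      _ = ∑ i ∈ Finset.range (t y), b.get i := hpre y
      _ < a y := hbig y
      _ ≤ ∑ i ∈ C₂, a i := Finset.single_le_sum (fun i _ => Nat.zero_le _) hy
end

section
/- Let c and n be positive integers and let 𝐜 : ℕ → [c] be a c-coloring of the positive integers. Then there exist n-term arithmetic progressions P₁, P₂, P₃, … (each with positive common difference) and colors α₁, …, α_n ∈ [c] such that: (a) for every nonempty finite set C of indices and every s ∈ {1, …, n}, 𝐜(∑_{i∈C} P_i[s]) = α_s; (b) for all nonempty finite sets C₁ < C₂ of indices, ⊕_{i∈C₁} P_i ≺ ⊕_{i∈C₂} P_i; and (c) for every nonempty finite set C of indices, the common difference of ⊕_{i∈C} P_i equals its first term ⊕_{i∈C} P_i [1] (so in particular the common difference of every such finite sum has color α₁). -/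
theorem hindman_aux {K : Type} [Finite K] (f : ℕ → K) :
    ∃ (b : ℕ → ℕ) (k : K), (∀ i, 0 < b i) ∧
      ∀ C : Finset ℕ, C.Nonempty → f (∑ i ∈ C, b i) = k := by
  have hpos : ∀ (a : Stream' ℕ) (m : ℕ), m ∈ Hindman.FS a → (∀ i, 0 < a.get i) → 0 < m := by
    intro a m hm
    induction hm with
    | head' a => intro h; exact h 0
    | tail' a m _ ih => intro h; exact ih (fun i => h (i + 1))
    | cons' a m _ ih => intro h; exact Nat.add_pos_left (h 0) _
  obtain ⟨c, ⟨k, rfl⟩, b, hb⟩ := Hindman.FS_partition_regular (M := ℕ) (Stream'.const 1)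
    (Set.range (fun k : K => {x : ℕ | 0 < x ∧ f x = k})) (Set.finite_range _) (by
      intro x hx
      refine ⟨_, ⟨f x, rfl⟩, hpos _ x hx (fun i => ?_), rfl⟩
      simp)
  refine ⟨b.get, k, fun i => (hb (Hindman.FS.singleton b i)).1, fun C hC => ?_⟩
  exact (hb (Hindman.FS.finsetSum b C hC)).2

def blockN (b : ℕ → ℕ) : ℕ → ℕ
  | 0 => 0
  | i + 1 => blockN b i + ((∑ j ∈ Finset.range (blockN b i), b j) + 1)

theorem hindman_growing {K : Type} [Finite K] (f : ℕ → K) :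
    ∃ (a : ℕ → ℕ) (k : K), (∀ i, 0 < a i) ∧
      (∀ C : Finset ℕ, C.Nonempty → f (∑ i ∈ C, a i) = k) ∧
      ∀ j, ∑ i ∈ Finset.range j, a i < a j := by
  obtain ⟨b, k, hb, hk⟩ := hindman_aux f
  have hN : ∀ i, blockN b (i + 1) =
      blockN b i + ((∑ j ∈ Finset.range (blockN b i), b j) + 1) := fun i => rfl
  have hmono : Monotone (blockN b) := monotone_nat_of_le_succ (fun i => by rw [hN]; omega)
  have hsum : ∀ j, ∑ i ∈ Finset.range j, ∑ x ∈ Finset.Ico (blockN b i) (blockN b (i + 1)), b x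
      = ∑ x ∈ Finset.range (blockN b j), b x := by
    intro j
    induction j with
    | zero => simp [blockN]
    | succ j ih =>
      rw [Finset.sum_range_succ, ih, Finset.sum_range_add_sum_Ico _ (hmono (Nat.le_succ j))]
  have hgrow : ∀ j, ∑ x ∈ Finset.range (blockN b j), b x
      < ∑ x ∈ Finset.Ico (blockN b j) (blockN b (j + 1)), b x := by
    intro j
    have h1 : (Finset.Ico (blockN b j) (blockN b (j + 1))).card • 1
        ≤ ∑ x ∈ Finset.Ico (blockN b j) (blockN b (j + 1)), b x :=
      Finset.card_nsmul_le_sum _ _ _ (fun x _ => hb x)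
    rw [Nat.card_Ico, smul_eq_mul, mul_one] at h1
    have := hN j
    omega
  refine ⟨fun i => ∑ x ∈ Finset.Ico (blockN b i) (blockN b (i + 1)), b x, k,
    fun i => lt_of_le_of_lt (Nat.zero_le _) (hgrow i), ?_, fun j => ?_⟩
  · intro C hC
    rw [← Finset.sum_biUnion]
    · apply hk
      obtain ⟨i, hi⟩ := hC
      refine ⟨blockN b i, Finset.mem_biUnion.2 ⟨i, hi, Finset.mem_Ico.2 ⟨le_rfl, ?_⟩⟩⟩
      rw [hN]; omega
    · intro i _ j _ hij
      have := hmono.pairwise_disjoint_on_Ico_succ hij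
      simp only [Function.onFun, Nat.succ_eq_succ, Nat.succ_eq_add_one] at this ⊢
      rw [← Finset.disjoint_coe]
      simpa using this
  · rw [hsum]; exact hgrow j

/-- Strengthened inductive lemma: for any `c`-coloring of the positive
integers there are `n`-term arithmetic progressions `P₁, P₂, …` (first term
`a i`, common difference `d i`) and colors `α₁, …, α_n` such that (a) the
`s`-th term of any finite pointwise sum has color `α_s`, (b) `C₁ < C₂` implies
`⊕_{i∈C₁} Pᵢ ≺ ⊕_{i∈C₂} Pᵢ`, and (c) the common difference of each finite
pointwise sum equals its first term. -/
theorem progressions_with_termwise_colors_and_diff_eq_first (c n : ℕ)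
    (hc : 0 < c) (hn : 0 < n) (col : ℕ → Fin c) :
    ∃ a d : ℕ → ℕ, ∃ α : ℕ → Fin c,
      (∀ i, 0 < a i) ∧ (∀ i, 0 < d i) ∧
      -- (a) the s-th term of every finite pointwise sum has color α s
      (∀ C : Finset ℕ, C.Nonempty → ∀ s, 1 ≤ s → s ≤ n →
        col (∑ i ∈ C, (a i + (s - 1) * d i)) = α s) ∧
      -- (b) C₁ < C₂ implies ⊕_{i∈C₁} Pᵢ ≺ ⊕_{i∈C₂} Pᵢ
      (∀ C₁ C₂ : Finset ℕ, C₁.Nonempty → C₂.Nonempty →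
        (∀ x ∈ C₁, ∀ y ∈ C₂, x < y) →
        ∀ s, 1 ≤ s → s ≤ n →
          ∑ i ∈ C₁, (a i + (s - 1) * d i) < ∑ i ∈ C₂, (a i + (s - 1) * d i)) ∧
      -- (c) the common difference of ⊕_{i∈C} Pᵢ equals its first term
      (∀ C : Finset ℕ, C.Nonempty → ∑ i ∈ C, d i = ∑ i ∈ C, a i) := by
  obtain ⟨a, k, ha, hk, hg⟩ := hindman_growing (fun x => fun s : Fin (n + 1) => col (s * x))
  have hterm : ∀ (C : Finset ℕ) (s : ℕ), 1 ≤ s →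
      ∑ i ∈ C, (a i + (s - 1) * a i) = s * ∑ i ∈ C, a i := by
    intro C s hs
    rw [Finset.mul_sum]
    refine Finset.sum_congr rfl (fun i _ => ?_)
    obtain ⟨t, rfl⟩ := Nat.exists_eq_add_of_le hs
    rw [Nat.add_sub_cancel_left]; ring
  refine ⟨a, a, fun s => k (Fin.ofNat (n + 1) s), ha, ha, ?_, ?_, fun _ _ => rfl⟩
  · intro C hC s h1 h2
    rw [hterm C s h1, ← hk C hC]
    simp [Nat.mod_eq_of_lt (Nat.lt_succ_of_le h2)]
  · intro C₁ C₂ _ h2 hlt s hs _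
    rw [hterm _ _ hs, hterm _ _ hs]
    refine Nat.mul_lt_mul_of_pos_left ?_ hs
    obtain ⟨y, hy⟩ := h2
    calc ∑ i ∈ C₁, a i ≤ ∑ i ∈ Finset.range y, a i :=
          Finset.sum_le_sum_of_subset (fun x hx => Finset.mem_range.2 (hlt x hx y hy))
      _ < a y := hg y
      _ ≤ ∑ i ∈ C₂, a i := Finset.single_le_sum (f := a) (fun _ _ => Nat.zero_le _) hy
end

section
/- Let a₁ < a₂ < ⋯ < a_m < ⋯ be an infinite strictly increasing sequence of positive integers, let c be a positive integer, and let FS({a₁, a₂, …}) — the set of all sums of finitely many distinct terms of the sequence — be c-colored. Then there exist nonempty finite sets B₁ < B₂ < B₃ < ⋯ of indices such that, setting b_j = ∑_{i∈B_j} a_i for each j, the set FS({b₁, b₂, …}) is monochromatic. -/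
inductive HM : Type
  | bot : HM
  | mk : Finset ℕ → HM

def HM.lt (A B : Finset ℕ) : Prop := ∀ x ∈ A, ∀ y ∈ B, x < y

open Classical in
noncomputable def HM.mul : HM → HM → HM
  | HM.mk A, HM.mk B => if HM.lt A B then HM.mk (A ∪ B) else HM.bot
  | _, _ => HM.bot

theorem HM.mul_some {A B : Finset ℕ} (h : HM.lt A B) :
    HM.mul (HM.mk A) (HM.mk B) = HM.mk (A ∪ B) := by
  simp [HM.mul, h]

theorem HM.mul_some_neg {A B : Finset ℕ} (h : ¬ HM.lt A B) :
    HM.mul (HM.mk A) (HM.mk B) = HM.bot := by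
  simp [HM.mul, h]

theorem HM.lt_union_left {A B C : Finset ℕ} :
    HM.lt (A ∪ B) C ↔ HM.lt A C ∧ HM.lt B C := by
  simp only [HM.lt, Finset.mem_union]
  grind

theorem HM.lt_union_right {A B C : Finset ℕ} :
    HM.lt A (B ∪ C) ↔ HM.lt A B ∧ HM.lt A C := by
  simp only [HM.lt, Finset.mem_union]
  grind

theorem HM.mul_assoc' (x y z : HM) : HM.mul (HM.mul x y) z = HM.mul x (HM.mul y z) := by
  rcases x with _ | A <;> rcases y with _ | B <;> rcases z with _ | C <;> try (simp [HM.mul]; done)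
  by_cases h1 : HM.lt A B <;> by_cases h2 : HM.lt B C <;> by_cases h3 : HM.lt A C <;>
    simp [HM.mul, h1, h2, h3, HM.lt_union_left, HM.lt_union_right, Finset.union_assoc]

noncomputable instance : Semigroup HM where
  mul := HM.mul
  mul_assoc := HM.mul_assoc'

theorem HM.FP_base (s : Stream' HM) (m : HM) (h : m ∈ Hindman.FP s) :
    ∀ n : ℕ, (∀ i, s.get i = (HM.mk {i + n})) →
      ∃ A : Finset ℕ, m = (HM.mk A) ∧ A.Nonempty ∧ ∀ x ∈ A, n ≤ x := by
  induction h with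
  | head' s =>
    intro n hs
    refine ⟨{n}, ?_, by simp, by simp⟩
    have := hs 0
    rw [Nat.zero_add] at this
    exact this
  | tail' s m h ih =>
    intro n hs
    obtain ⟨A, h1, h2, h3⟩ := ih (n + 1) (fun i => by
      have := hs (i + 1)
      rw [show i + (n + 1) = i + 1 + n by ring]; exact this)
    exact ⟨A, h1, h2, fun x hx => by have := h3 x hx; omega⟩
  | cons' s m h ih =>
    intro n hs
    obtain ⟨A, h1, h2, h3⟩ := ih (n + 1) (fun i => by
      have := hs (i + 1)
      rw [show i + (n + 1) = i + 1 + n by ring]; exact this)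
    have h0 : s.head = (HM.mk {n}) := by
      have := hs 0
      rw [Nat.zero_add] at this
      exact this
    refine ⟨{n} ∪ A, ?_, by simp, ?_⟩
    · rw [h0, h1]
      refine HM.mul_some ?_
      intro x hx y hy
      have := h3 y hy
      simp at hx
      omega
    · intro x hx
      simp at hx
      rcases hx with rfl | hx
      · exact le_rfl
      · have := h3 x hx; omega

theorem HM.biUnion_mem (b : Stream' HM) (B : ℕ → Finset ℕ)
    (hb : ∀ i, b.get i = (HM.mk (B i)))
    (hB : ∀ i j, i < j → HM.lt (B i) (B j)) (S : Finset ℕ) :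
    S.Nonempty → ∀ n, (∀ i ∈ S, n ≤ i) →
      ((HM.mk (S.biUnion B)) : HM) ∈ Hindman.FP (b.drop n) := by
  induction S using Finset.induction_on_min with
  | empty => intro h; simp at h
  | insert a s ha ih =>
    intro _ n hn
    have han : n ≤ a := hn a (by simp)
    obtain ⟨d, rfl⟩ := Nat.exists_eq_add_of_le han
    apply Hindman.FP_drop_subset_FP _ d
    rw [Stream'.drop_drop]
    have hd : (b.drop (n + d)).head = (HM.mk (B (n + d))) := by
      rw [Stream'.head_drop]; exact hb _
    rcases s.eq_empty_or_nonempty with rfl | hs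
    · have := Hindman.FP.head (b.drop (n + d))
      rw [hd] at this
      simpa using this
    · have h1 := ih hs (n + d + 1) (fun i hi => ha i hi)
      rw [← Stream'.drop_drop, ← Stream'.tail_eq_drop] at h1
      have h2 := Hindman.FP.cons _ _ h1
      rw [hd] at h2
      have h3 : HM.lt (B (n + d)) (s.biUnion B) := by
        intro x hx y hy
        obtain ⟨j, hj, hy⟩ := Finset.mem_biUnion.1 hy
        exact hB _ _ (ha j hj) x hx y hy
      have h4 := HM.mul_some h3
      rw [← Finset.biUnion_insert] at h4
      rw [← h4]
      exact h2


/-- Strong version of Hindman's theorem: if `a 0 < a 1 < ⋯` is a strictly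
increasing sequence of positive integers and the finite sums of the `a i`
are `c`-colored, then there are nonempty finite index sets `B₁ < B₂ < ⋯`
such that, with `b_j = ∑_{i∈B_j} a i`, the set of finite sums of the `b_j`
is monochromatic. -/
theorem hindman_strong (a : ℕ → ℕ) (hpos : ∀ i, 0 < a i)
    (hmono : StrictMono a) (c : ℕ) (hc : 0 < c) (col : ℕ → Fin c) :
    ∃ B : ℕ → Finset ℕ,
      (∀ j, (B j).Nonempty) ∧
      (∀ j k, j < k → ∀ x ∈ B j, ∀ y ∈ B k, x < y) ∧
      ∃ γ : Fin c, ∀ S : Finset ℕ, S.Nonempty →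
        col (∑ j ∈ S, ∑ i ∈ B j, a i) = γ := by
  let s : Fin c → Set HM := fun γ =>
    {m | ∃ A : Finset ℕ, m = (HM.mk A) ∧ A.Nonempty ∧ col (∑ i ∈ A, a i) = γ}
  let st : Stream' HM := fun i => (HM.mk {i})
  obtain ⟨t, ⟨γ, rfl⟩, b, hbs⟩ := Hindman.FP_partition_regular st (Set.range s)
    (Set.finite_range s) (by
      intro m hm
      obtain ⟨A, h1, h2, -⟩ := HM.FP_base st m hm 0 (fun i => rfl)
      exact ⟨s _, ⟨col (∑ i ∈ A, a i), rfl⟩, A, h1, h2, rfl⟩)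
  choose B hb hne _ using fun i => hbs (Hindman.FP.singleton b i)
  have hB : ∀ i j, i < j → HM.lt (B i) (B j) := by
    intro i j hij
    by_contra hlt
    obtain ⟨A, h1, -⟩ := hbs (Hindman.FP.mul_two b i j hij)
    rw [hb, hb] at h1
    have h2 := (HM.mul_some_neg hlt).symm.trans h1
    cases h2
  refine ⟨B, hne, hB, γ, fun S hS => ?_⟩
  obtain ⟨A, h1, -, h3⟩ := hbs (HM.biUnion_mem b B hb hB S hS 0 (fun i _ => Nat.zero_le i))
  have h4 : S.biUnion B = A := HM.mk.inj h1
  rw [← Finset.sum_biUnion, h4, h3]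
  intro i _ j _ hij
  refine Finset.disjoint_left.2 fun x hx hx' => ?_
  rcases lt_or_gt_of_ne hij with h | h
  · exact lt_irrefl _ (hB _ _ h x hx x hx')
  · exact lt_irrefl _ (hB _ _ h x hx' x hx)
end

section
/- For all positive integers n and c there exists a positive integer m with the following property: for every m-element set A = {a₁, …, a_m} of pairwise power-disjoint positive integers and every c-coloring 𝐜 of FS(A), there exist a color γ ∈ [c] and nonempty subsets B₁ < B₂ < ⋯ < B_n of {1, …, m} such that for every set C that is a union of a nonempty subfamily of {B₁, …, B_n}, one has 𝐜(∑_{i∈C} a_i) = γ. -/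
/-- Ordered union: absorbing value is the empty set. -/
def ordU (F G : Finset ℕ) : Finset ℕ :=
  open Classical in
  if F.Nonempty ∧ G.Nonempty ∧ ∀ x ∈ F, ∀ y ∈ G, x < y then F ∪ G else ∅

theorem ordU_pos {F G : Finset ℕ} (hF : F.Nonempty) (hG : G.Nonempty)
    (h : ∀ x ∈ F, ∀ y ∈ G, x < y) : ordU F G = F ∪ G := by
  unfold ordU; rw [if_pos ⟨hF, hG, h⟩]

theorem ordU_ne {F G : Finset ℕ} (h : (ordU F G).Nonempty) :
    F.Nonempty ∧ G.Nonempty ∧ ∀ x ∈ F, ∀ y ∈ G, x < y := by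
  by_contra hc
  unfold ordU at h
  rw [if_neg hc] at h
  simp at h

theorem ordU_assoc (F G H : Finset ℕ) : ordU (ordU F G) H = ordU F (ordU G H) := by
  by_cases h : (ordU (ordU F G) H).Nonempty
  · obtain ⟨h1, h2, h3⟩ := ordU_ne h
    obtain ⟨h4, h5, h6⟩ := ordU_ne h1
    rw [ordU_pos h1 h2 h3]
    rw [ordU_pos h4 h5 h6] at h3 ⊢
    have h7 : ∀ x ∈ G, ∀ y ∈ H, x < y := fun x hx => h3 x (Finset.mem_union_right _ hx)
    have h8 : ∀ x ∈ F, ∀ y ∈ H, x < y := fun x hx => h3 x (Finset.mem_union_left _ hx)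
    rw [ordU_pos h5 h2 h7, ordU_pos h4 (h5.mono Finset.subset_union_left), Finset.union_assoc]
    intro x hx y hy
    rcases Finset.mem_union.1 hy with hy | hy
    exacts [h6 x hx y hy, h8 x hx y hy]
  · by_cases h' : (ordU F (ordU G H)).Nonempty
    · exfalso
      apply h
      obtain ⟨h1, h2, h3⟩ := ordU_ne h'
      obtain ⟨h4, h5, h6⟩ := ordU_ne h2
      rw [ordU_pos h4 h5 h6] at h3
      have h7 : ∀ x ∈ F, ∀ y ∈ G, x < y := fun x hx y hy => h3 x hx y (Finset.mem_union_left _ hy)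
      have h8 : ∀ x ∈ F, ∀ y ∈ H, x < y := fun x hx y hy => h3 x hx y (Finset.mem_union_right _ hy)
      rw [ordU_pos h1 h4 h7, ordU_pos (h1.mono Finset.subset_union_left) h5]
      · exact (h1.mono Finset.subset_union_left).mono Finset.subset_union_left
      · intro x hx y hy
        rcases Finset.mem_union.1 hx with hx | hx
        exacts [h8 x hx y hy, h6 x hx y hy]
    · rw [Finset.not_nonempty_iff_eq_empty.1 h, Finset.not_nonempty_iff_eq_empty.1 h']

@[reducible] def ordSemi : Semigroup (Finset ℕ) where
  mul := ordU
  mul_assoc := ordU_assoc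

attribute [local instance] ordSemi

theorem omul (F G : Finset ℕ) : F * G = ordU F G := rfl

theorem fp_single (a : Stream' (Finset ℕ)) (x : Finset ℕ) (h : x ∈ Hindman.FP a) :
    ∀ k, (∀ i, a.get i = {k + i}) → x.Nonempty ∧ ∀ y ∈ x, k ≤ y := by
  induction h with
  | head' a =>
    intro k hk
    have := hk 0
    rw [Stream'.head, this]; simp
  | tail' a m hm ih =>
    intro k hk
    obtain ⟨h1, h2⟩ := ih (k+1) (fun i => by
      rw [Stream'.get_tail, hk]; congr 1; omega)
    exact ⟨h1, fun y hy => by have := h2 y hy; omega⟩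
  | cons' a m hm ih =>
    intro k hk
    obtain ⟨h1, h2⟩ := ih (k+1) (fun i => by
      rw [Stream'.get_tail, hk]; congr 1; omega)
    have h0 : a.head = {k} := by have := hk 0; rw [Stream'.head, this]; simp
    rw [h0, omul, ordU_pos (by simp) h1]
    · refine ⟨by simp, ?_⟩
      intro y hy
      rcases Finset.mem_union.1 hy with hy | hy
      · simp at hy; omega
      · have := h2 y hy; omega
    · intro x hx y hy
      simp at hx
      have := h2 y hy; omega

theorem fp_union (b : Stream' (Finset ℕ)) (hne : ∀ j, (b.get j).Nonempty)
    (hlt : ∀ j k, j < k → ∀ x ∈ b.get j, ∀ y ∈ b.get k, x < y) :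
    ∀ N k (S : Finset ℕ), S.Nonempty → (∀ i ∈ S, k ≤ i ∧ i < k + N) →
      S.biUnion b.get ∈ Hindman.FP (b.drop k) := by
  intro N
  induction N with
  | zero =>
    intro k S ⟨i, hi⟩ h
    have := h i hi; omega
  | succ N ih =>
    intro k S hS h
    have htail : (b.drop k).tail = b.drop (k+1) := by
      rw [Stream'.tail_drop', ← Stream'.drop_tail']
    have hhead : (b.drop k).head = b.get k := by simp [Stream'.head_drop]
    by_cases hk : k ∈ S
    · by_cases hS' : (S.erase k).Nonempty
      · have h1 := ih (k+1) (S.erase k) hS' (fun i hi => by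
          have h2 := Finset.mem_erase.1 hi
          have := h i h2.2; omega)
        have h3 : S.biUnion b.get = (b.drop k).head * (S.erase k).biUnion b.get := by
          rw [hhead, omul, ordU_pos (hne k)]
          · conv_lhs => rw [← Finset.insert_erase hk, Finset.biUnion_insert]
          · obtain ⟨j, hj⟩ := hS'
            obtain ⟨x, hx⟩ := hne j
            exact ⟨x, Finset.mem_biUnion.2 ⟨j, hj, hx⟩⟩
          · intro x hx y hy
            obtain ⟨j, hj, hy⟩ := Finset.mem_biUnion.1 hy
            have h2 := Finset.mem_erase.1 hj
            have := h j h2.2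
            exact hlt k j (by omega) x hx y hy
        rw [h3]
        apply Hindman.FP.cons'
        rw [htail]; exact h1
      · have : S = {k} := by
          rw [Finset.not_nonempty_iff_eq_empty] at hS'
          rw [← Finset.insert_erase hk, hS']; rfl
        rw [this, Finset.singleton_biUnion, ← hhead]
        exact Hindman.FP.head' _
    · apply Hindman.FP.tail'
      rw [htail]
      refine ih (k+1) S hS (fun i hi => ?_)
      have h1 : i ≠ k := fun e => hk (e ▸ hi)
      have := h i hi; omega

theorem inf_hindman (c : ℕ) (col : Finset ℕ → Fin c) :
    ∃ γ : Fin c, ∃ B : ℕ → Finset ℕ, (∀ j, (B j).Nonempty) ∧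
      (∀ j k, j < k → ∀ x ∈ B j, ∀ y ∈ B k, x < y) ∧
      ∀ S : Finset ℕ, S.Nonempty → col (S.biUnion B) = γ := by
  obtain ⟨t, ht, b, hb⟩ := Hindman.FP_partition_regular (M := Finset ℕ)
    (fun i => {i} : Stream' (Finset ℕ))
    (Set.range fun γ : Fin c => {F : Finset ℕ | F.Nonempty ∧ col F = γ})
    (Set.finite_range _) (by
      intro x hx
      have := fp_single _ x hx 0 (fun i => by simp [Stream'.get])
      exact ⟨_, ⟨col x, rfl⟩, this.1, rfl⟩)
  obtain ⟨γ, rfl⟩ := ht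
  have hne : ∀ j, (b.get j).Nonempty := fun j => (hb (Hindman.FP.singleton b j)).1
  have hlt : ∀ j k, j < k → ∀ x ∈ b.get j, ∀ y ∈ b.get k, x < y := fun j k hjk =>
    (ordU_ne (hb (Hindman.FP.mul_two b j k hjk)).1).2.2
  refine ⟨γ, b.get, hne, hlt, fun S hS => ?_⟩
  have := fp_union b hne hlt (S.sup id + 1) 0 S hS (fun i hi => by
    have : i ≤ S.sup id := Finset.le_sup (f := id) hi
    omega)
  exact (hb this).2

theorem finitary_hindman (n c : ℕ) (hn : 0 < n) (hc : 0 < c) :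
    ∃ m : ℕ, 0 < m ∧
      ∀ a : Fin m → ℕ, (∀ i, 0 < a i) →
        (∀ i j : Fin m, i ≠ j → PowerDisjoint (a i) (a j)) →
        ∀ col : ℕ → Fin c,
          ∃ γ : Fin c, ∃ B : Fin n → Finset (Fin m),
            (∀ j, (B j).Nonempty) ∧
            (∀ j k : Fin n, j < k → ∀ x ∈ B j, ∀ y ∈ B k, x < y) ∧
            (∀ S : Finset (Fin n), S.Nonempty →
              col (∑ i ∈ S.biUnion B, a i) = γ) := by
  by_contra hcon
  have hbad : ∀ m : ℕ, ∃ a : Fin (m+1) → ℕ, ∃ col : ℕ → Fin c,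
      ¬ ∃ γ : Fin c, ∃ B : Fin n → Finset (Fin (m+1)),
            (∀ j, (B j).Nonempty) ∧
            (∀ j k : Fin n, j < k → ∀ x ∈ B j, ∀ y ∈ B k, x < y) ∧
            (∀ S : Finset (Fin n), S.Nonempty →
              col (∑ i ∈ S.biUnion B, a i) = γ) := by
    intro m
    by_contra h
    push Not at h
    exact hcon ⟨m+1, by omega, fun a _ _ col => h a col⟩
  choose a col hbad using hbad
  let colm : ℕ → Finset ℕ → Fin c := fun m F =>
    col m (∑ i ∈ Finset.univ.filter (fun i : Fin (m+1) => (i : ℕ) ∈ F), a m i)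
  let U : Ultrafilter ℕ := Filter.hyperfilter ℕ
  have hlim : ∀ F, ∃ γ, ∀ᶠ m in (U : Filter ℕ), colm m F = γ := by
    intro F
    have h := (Ultrafilter.eventually_exists_iff (f := U) (P := fun γ m => colm m F = γ)).1
      (Filter.Eventually.of_forall fun m => ⟨_, rfl⟩)
    exact h
  choose L hL using hlim
  obtain ⟨γ, B, hne, hlt, hcol⟩ := inf_hindman c L
  have h1 : ∀ᶠ m in (U : Filter ℕ), ∀ S : Finset (Fin n),
      colm m (S.biUnion fun j => B j) = L (S.biUnion fun j => B j) := by
    rw [Filter.eventually_all]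
    exact fun S => hL _
  have h2 : ∀ᶠ m in (U : Filter ℕ), ((Finset.range n).biUnion B).sup id ≤ m :=
    Nat.hyperfilter_le_atTop (Filter.eventually_ge_atTop _)
  obtain ⟨m, h1, h2⟩ := (h1.and h2).exists
  have hle : ∀ j : Fin n, ∀ x ∈ B j, x < m + 1 := by
    intro j x hx
    have : x ≤ ((Finset.range n).biUnion B).sup id :=
      Finset.le_sup (f := id) (Finset.mem_biUnion.2 ⟨j, Finset.mem_range.2 j.2, hx⟩)
    omega
  apply hbad m
  refine ⟨γ, fun j => Finset.univ.filter (fun i : Fin (m+1) => (i : ℕ) ∈ B j), ?_, ?_, ?_⟩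
  · intro j
    obtain ⟨x, hx⟩ := hne j
    exact ⟨⟨x, hle j x hx⟩, by simpa using hx⟩
  · intro j k hjk x hx y hy
    simp only [Finset.mem_filter, Finset.mem_univ, true_and] at hx hy
    exact hlt j k hjk x hx y hy
  · intro S hS
    have h3 := hcol (S.map Fin.valEmbedding) (by simpa using hS)
    have h4 : (S.map Fin.valEmbedding).biUnion B = S.biUnion fun j => B j := by
      ext x; simp
    rw [h4, ← h1 S] at h3
    rw [← h3]
    show _ = col m _
    congr 2
    ext x; simp
end
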